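/- Fix n ≥ 2, let χ⁺_i, χ⁻_i ∈ ℂ* for i = 1,…,n−1, and let D be an invertible diagonal n×n complex matrix satisfying D_kk/D_{k+1,k+1} = χ⁺_k/χ⁻_k for k = 1,…,n−1. Then the matrices D·ḡ_1(χ⁺_1)⋯ḡ_{n−1}(χ⁺_{n−1}) and D·g_1(χ⁻_1)⋯g_{n−1}(χ⁻_{n−1}) have the same characteristic polynomial; in particular equal traces. (The two expressions for the characters Ch_V on a Coxeter symplectic leaf agree, specialized to SL_n.) -/

import Mathlib

open scoped Matrix

/-- `gbar n i x` is the `n×n` identity matrix except that its `2×2` submatrix in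
rows and columns `i, i+1` (1-based indexing, `1 ≤ i ≤ n-1`) is `[[1, x], [−1, 1−x]]`. -/
def gbar (n : ℕ) (i : ℕ) (x : ℂ) : Matrix (Fin n) (Fin n) ℂ := fun j k =>
  if (j : ℕ) + 1 = i ∧ (k : ℕ) + 1 = i then 1
  else if (j : ℕ) + 1 = i ∧ (k : ℕ) = i then x
  else if (j : ℕ) = i ∧ (k : ℕ) + 1 = i then -1
  else if (j : ℕ) = i ∧ (k : ℕ) = i then 1 - x
  else if j = k then 1 else 0

/-- `gmat n i x` is the `n×n` identity matrix except that its `2×2` submatrix in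
rows and columns `i, i+1` (1-based indexing, `1 ≤ i ≤ n-1`) is `[[1−x, x], [−1, 1]]`. -/
def gmat (n : ℕ) (i : ℕ) (x : ℂ) : Matrix (Fin n) (Fin n) ℂ := fun j k =>
  if (j : ℕ) + 1 = i ∧ (k : ℕ) + 1 = i then 1 - x
  else if (j : ℕ) + 1 = i ∧ (k : ℕ) = i then x
  else if (j : ℕ) = i ∧ (k : ℕ) + 1 = i then -1
  else if (j : ℕ) = i ∧ (k : ℕ) = i then 1
  else if j = k then 1 else 0

/-- The strictly lower elementary matrix with entry `-1` at `(i+1, i)` (1-based). -/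
def lowE (n : ℕ) (i : ℕ) : Matrix (Fin n) (Fin n) ℂ := fun j k =>
  if (j : ℕ) = i ∧ (k : ℕ) + 1 = i then -1 else 0

/-- The strictly upper elementary matrix with entry `x` at `(i, i+1)` (1-based). -/
def uppE (n : ℕ) (i : ℕ) (x : ℂ) : Matrix (Fin n) (Fin n) ℂ := fun j k =>
  if (j : ℕ) + 1 = i ∧ (k : ℕ) = i then x else 0

lemma lowE_mul_uppE (n i j : ℕ) (h : i ≠ j) (x : ℂ) : lowE n i * uppE n j x = 0 := by
  ext a b
  rw [Matrix.mul_apply]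
  refine Finset.sum_eq_zero fun c _ => ?_
  simp only [lowE, uppE]
  split_ifs <;> first | omega | simp

lemma uppE_mul_lowE (n i j : ℕ) (h : i ≠ j) (x : ℂ) : uppE n j x * lowE n i = 0 := by
  ext a b
  rw [Matrix.mul_apply]
  refine Finset.sum_eq_zero fun c _ => ?_
  simp only [lowE, uppE]
  split_ifs <;> first | omega | simp

lemma commute_low_upp (n i j : ℕ) (h : i ≠ j) (x : ℂ) :
    Commute (1 + lowE n i) (1 + uppE n j x) := by
  unfold Commute SemiconjBy
  simp only [add_mul, mul_add, one_mul, mul_one, lowE_mul_uppE n i j h, uppE_mul_lowE n i j h]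
  abel

lemma gbar_eq (n i : ℕ) (h1 : 1 ≤ i) (h2 : i < n) (x : ℂ) :
    gbar n i x = (1 + lowE n i) * (1 + uppE n i x) := by
  simp only [add_mul, mul_add, one_mul, mul_one]
  ext a b
  simp only [Matrix.add_apply, Matrix.mul_apply]
  rw [Finset.sum_eq_single (⟨i - 1, by omega⟩ : Fin n)
    (by
      intro c _ hc
      have : (c : ℕ) ≠ i - 1 := fun h => hc (Fin.ext h)
      simp only [lowE]
      rw [if_neg (by omega), zero_mul])
    (by simp)]
  have e : i - 1 + 1 = i := by omega
  simp only [gbar, lowE, uppE, Matrix.one_apply, Fin.ext_iff, e, and_true, true_and]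
  split_ifs <;> first | omega | (simp; try ring)

lemma gmat_eq (n i : ℕ) (h1 : 1 ≤ i) (h2 : i < n) (x : ℂ) :
    gmat n i x = (1 + uppE n i x) * (1 + lowE n i) := by
  simp only [add_mul, mul_add, one_mul, mul_one]
  ext a b
  simp only [Matrix.add_apply, Matrix.mul_apply]
  rw [Finset.sum_eq_single (⟨i, h2⟩ : Fin n)
    (by
      intro c _ hc
      have : (c : ℕ) ≠ i := fun h => hc (Fin.ext h)
      simp only [uppE]
      rw [if_neg (by omega), zero_mul])
    (by simp)]
  simp only [gmat, lowE, uppE, Matrix.one_apply, Fin.ext_iff, and_true, true_and]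
  split_ifs <;> first | omega | (simp; try ring)

lemma prod_map_mul_of_commute {M : Type*} [Monoid M] (f g : ℕ → M)
    (h : ∀ i j, i ≠ j → Commute (g i) (f j)) (l : List ℕ) (hl : l.Nodup) :
    (l.map (fun i => f i * g i)).prod = (l.map f).prod * (l.map g).prod := by
  induction l with
  | nil => simp
  | cons a t ih =>
    rw [List.nodup_cons] at hl
    have hc : Commute (g a) (t.map f).prod := by
      apply Commute.list_prod_right
      intro y hy
      obtain ⟨b, hb, rfl⟩ := List.mem_map.1 hy
      exact h a b (fun e => hl.1 (e ▸ hb))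
    simp only [List.map_cons, List.prod_cons, ih hl.2]
    rw [mul_assoc, ← mul_assoc (g a), hc.eq]
    simp only [mul_assoc]

lemma semiconj_prod {M : Type*} [Monoid M] (D : M) (f g : ℕ → M) (l : List ℕ)
    (h : ∀ i ∈ l, D * f i = g i * D) :
    D * (l.map f).prod = (l.map g).prod * D := by
  induction l with
  | nil => simp
  | cons a t ih =>
    simp only [List.map_cons, List.prod_cons]
    rw [← mul_assoc, h a (by simp), mul_assoc, ih (fun i hi => h i (by simp [hi])), mul_assoc]

/-- The two expressions for the characters `Ch_V` on a Coxeter symplectic leaf agree,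
specialized to `SL_n`: if `D = diag(d)` is invertible diagonal with
`d_k/d_{k+1} = χ⁺_k/χ⁻_k` for `k = 1,…,n−1`, then `D·ḡ₁(χ⁺₁)⋯ḡ_{n−1}(χ⁺_{n−1})` and
`D·g₁(χ⁻₁)⋯g_{n−1}(χ⁻_{n−1})` have the same characteristic polynomial,
in particular equal traces. -/
theorem characters_two_expressions_agree
    (n : ℕ) (hn : 2 ≤ n) (χp χm : ℕ → ℂ)
    (hχp : ∀ i, 1 ≤ i → i ≤ n - 1 → χp i ≠ 0)
    (hχm : ∀ i, 1 ≤ i → i ≤ n - 1 → χm i ≠ 0)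
    (d : Fin n → ℂ) (hd : ∀ k, d k ≠ 0)
    (hratio : ∀ k, (hk1 : 1 ≤ k) → (hk2 : k ≤ n - 1) →
      d ⟨k - 1, by omega⟩ / d ⟨k, by omega⟩ = χp k / χm k) :
    (Matrix.diagonal d *
        ((List.range' 1 (n - 1)).map (fun i => gbar n i (χp i))).prod).charpoly =
      (Matrix.diagonal d *
        ((List.range' 1 (n - 1)).map (fun i => gmat n i (χm i))).prod).charpoly ∧
    (Matrix.diagonal d *
        ((List.range' 1 (n - 1)).map (fun i => gbar n i (χp i))).prod).trace =
      (Matrix.diagonal d *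
        ((List.range' 1 (n - 1)).map (fun i => gmat n i (χm i))).prod).trace := by
  have key : (Matrix.diagonal d *
        ((List.range' 1 (n - 1)).map (fun i => gbar n i (χp i))).prod).charpoly =
      (Matrix.diagonal d *
        ((List.range' 1 (n - 1)).map (fun i => gmat n i (χm i))).prod).charpoly := by
    have hmem : ∀ i ∈ List.range' 1 (n - 1), 1 ≤ i ∧ i < n := by
      intro i hi
      rw [List.mem_range'_1] at hi
      omega
    have hnd : (List.range' 1 (n - 1)).Nodup := List.nodup_range'
    rw [List.map_congr_left (fun i hi => gbar_eq n i (hmem i hi).1 (hmem i hi).2 (χp i)),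
      List.map_congr_left (fun i hi => gmat_eq n i (hmem i hi).1 (hmem i hi).2 (χm i)),
      prod_map_mul_of_commute (fun i => 1 + lowE n i) (fun i => 1 + uppE n i (χp i))
        (fun i j hij => (commute_low_upp n j i hij.symm (χp i)).symm) _ hnd,
      prod_map_mul_of_commute (fun i => 1 + uppE n i (χm i)) (fun i => 1 + lowE n i)
        (fun i j hij => commute_low_upp n i j hij (χm j)) _ hnd,
      ← mul_assoc, ← mul_assoc,
      semiconj_prod (Matrix.diagonal d) (fun i => 1 + uppE n i (χm i))
        (fun i => 1 + uppE n i (χp i)), mul_assoc _ (Matrix.diagonal d), Matrix.charpoly_mul_comm]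
    intro i hi
    obtain ⟨h1, h2⟩ := hmem i hi
    have hr := hratio i h1 (by omega)
    rw [div_eq_div_iff (hd _) (hχm i h1 (by omega))] at hr
    simp only [mul_add, add_mul, mul_one, one_mul]
    congr 1
    ext a b
    rw [Matrix.diagonal_mul, Matrix.mul_diagonal]
    simp only [uppE]
    split_ifs with hab
    · have ha : a = ⟨i - 1, by omega⟩ := Fin.ext (by simp; omega)
      have hb : b = ⟨i, h2⟩ := Fin.ext hab.2
      rw [hb, ha]
      exact hr
    · simp
  refine ⟨key, ?_⟩
  have : Nonempty (Fin n) := ⟨⟨0, by omega⟩⟩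
  rw [Matrix.trace_eq_neg_charpoly_coeff, Matrix.trace_eq_neg_charpoly_coeff, key]
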